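/- Fix a finite type P of positions, a finite set S of relation symbols with arity function ar : S → ℕ, a conjunctive expression Φ over S with free variables F and existential variables E (both finite) whose arity sum is k, and an assignment σ : F → P. Then there exists a monotone k-DNF D over the index type of triples (p : P, ρ : S, i : Fin (ar ρ)), depending only on P, Φ, and σ and not on the interpretation, such that for every interpretation I of the symbols: if Φ is true at σ in the scene (P, S, ar, I), then D evaluates to true under the unary relational integracode of that scene. (Completeness direction: the expression implies its k-DNF encoding on arbitrary scenes.) -/

import Mathlib

/-- A conjunctive expression over relation symbols `S` (with arity function `ar`),
free variables `F` and existential variables `E`: a finite list of atoms, each an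
atom a symbol `ρ` together with an argument map `Fin (ar ρ) → F ⊕ E`. -/
structure ConjExpr (S : Type) (ar : S → ℕ) (F E : Type) : Type where
  atoms : List ((ρ : S) × (Fin (ar ρ) → F ⊕ E))

/-- The arity sum of a conjunctive expression: the sum of the arities of the symbols
occurring in its atoms. -/
def ConjExpr.aritySum {S : Type} {ar : S → ℕ} {F E : Type}
    (Φ : ConjExpr S ar F E) : ℕ :=
  (Φ.atoms.map fun a => ar a.1).sum

/-- Truth of a conjunctive expression at an assignment `σ : F → P` in the scene with
interpretation `I`: there is an assignment `τ` of the existential variables such that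
every atom's induced tuple lies in the interpretation of its symbol. -/
def ConjExpr.Holds {S : Type} {ar : S → ℕ} {F E : Type} {P : Type}
    (Φ : ConjExpr S ar F E) (I : ∀ ρ : S, Set (Fin (ar ρ) → P)) (σ : F → P) : Prop :=
  ∃ τ : E → P, ∀ a ∈ Φ.atoms, (fun i => Sum.elim σ τ (a.2 i)) ∈ I a.1

/-- A monotone `k`-DNF over index type `V`: a finite set of terms, each a finite set
of at most `k` indices. -/
def IsKDNF {V : Type} (k : ℕ) (D : Finset (Finset V)) : Prop :=
  ∀ T ∈ D, T.card ≤ k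

/-- Evaluation of a monotone DNF: true iff some term has all its indices true. -/
def DNFEval {V : Type} (D : Finset (Finset V)) (x : V → Bool) : Prop :=
  ∃ T ∈ D, ∀ v ∈ T, x v = true

/-- The DNF term describing the tuples that the assignments `σ` and `τ` require: it collects,
for every atom of `Φ` and every argument place `i`, the triple of the position put there,
the symbol of the atom, and `i`. -/
def ConjExpr.encodingTerm {P S F E : Type} [DecidableEq P] [DecidableEq S] {ar : S → ℕ}
    (Φ : ConjExpr S ar F E) (σ : F → P) (τ : E → P) :
    Finset ((_ : P) × (ρ : S) × Fin (ar ρ)) :=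
  (Φ.atoms.flatMap fun a =>
    List.ofFn fun i => ⟨Sum.elim σ τ (a.2 i), a.1, i⟩).toFinset

theorem ConjExpr.card_encodingTerm_le {P S F E : Type} [DecidableEq P] [DecidableEq S]
    {ar : S → ℕ} (Φ : ConjExpr S ar F E) (σ : F → P) (τ : E → P) :
    (Φ.encodingTerm σ τ).card ≤ Φ.aritySum := by
  refine (List.toFinset_card_le _).trans_eq ?_
  simp [ConjExpr.aritySum, List.length_flatMap]

theorem ConjExpr.mem_encodingTerm {P S F E : Type} [DecidableEq P] [DecidableEq S]
    {ar : S → ℕ} {Φ : ConjExpr S ar F E} {σ : F → P} {τ : E → P}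
    {v : (_ : P) × (ρ : S) × Fin (ar ρ)} :
    v ∈ Φ.encodingTerm σ τ ↔
      ∃ a ∈ Φ.atoms, ∃ i, (⟨Sum.elim σ τ (a.2 i), a.1, i⟩ : (_ : P) × (ρ : S) × Fin (ar ρ)) = v := by
  simp only [ConjExpr.encodingTerm, List.mem_toFinset, List.mem_flatMap, List.mem_ofFn]

/-- Completeness direction: for a conjunctive expression `Φ` of arity sum `k` and an
assignment `σ`, there is a monotone `k`-DNF `D` over the triples `(p, ρ, i)`,
depending only on `P`, `Φ` and `σ`, such that for every interpretation `I`, if `Φ`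
holds at `σ` then `D` evaluates to true under the unary relational integracode `X`
of the scene (the Boolean assignment with `X p ρ i = true` iff some tuple
`t ∈ I ρ` has `t i = p`). -/
theorem conjExpr_implies_kDNF_on_integracode
    {P S F E : Type} [Fintype P] [DecidableEq P] [Fintype S] [DecidableEq S]
    [Fintype F] [Fintype E]
    (ar : S → ℕ) (Φ : ConjExpr S ar F E) (k : ℕ) (hk : Φ.aritySum = k)
    (σ : F → P) :
    ∃ D : Finset (Finset ((_ : P) × (ρ : S) × Fin (ar ρ))),
      IsKDNF k D ∧
      ∀ (I : ∀ ρ : S, Set (Fin (ar ρ) → P))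
        (X : ((_ : P) × (ρ : S) × Fin (ar ρ)) → Bool),
        (∀ (p : P) (ρ : S) (i : Fin (ar ρ)),
            X ⟨p, ρ, i⟩ = true ↔ ∃ t ∈ I ρ, t i = p) →
        Φ.Holds I σ → DNFEval D X := by
  classical
  refine ⟨Finset.univ.image (Φ.encodingTerm σ), ?_, ?_⟩
  · intro T hT
    obtain ⟨τ, -, rfl⟩ := Finset.mem_image.mp hT
    exact hk ▸ Φ.card_encodingTerm_le σ τ
  · rintro I X hX ⟨τ, hτ⟩
    refine ⟨_, Finset.mem_image_of_mem _ (Finset.mem_univ τ), fun v hv => ?_⟩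
    obtain ⟨a, ha, i, rfl⟩ := ConjExpr.mem_encodingTerm.mp hv
    exact (hX _ _ _).mpr ⟨_, hτ a ha, rfl⟩
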